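/- (Melchior's inequality.) Let P be a finite set of points in the real projective plane ℝP², not all lying on one line, and for each integer k ≥ 2 let N_k denote the number of lines containing exactly k points of P. Then N₂ ≥ 3 + Σ_{k≥4} (k−3)·N_k. In particular P spans at least three ordinary lines. -/

import Mathlib

/-- The real projective plane: one-dimensional subspaces of `ℝ³`. -/
abbrev RP2 := Projectivization ℝ (Fin 3 → ℝ)

/-- A line in `ℝP²`: the set of points contained in a fixed
two-dimensional linear subspace of `ℝ³`. -/
def IsProjLine (L : Set RP2) : Prop :=
  ∃ W : Submodule ℝ (Fin 3 → ℝ), Module.finrank ℝ W = 2 ∧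
    L = {x : RP2 | x.submodule ≤ W}

/-- `numKRichLines P k` is the number of lines containing exactly `k` points of `P`. -/
noncomputable def numKRichLines (P : Set RP2) (k : ℕ) : ℕ :=
  {L : Set RP2 | IsProjLine L ∧ (P ∩ L).ncard = k}.ncard

section MelchiorCore
variable {ι : Type*}

/-- Affine functional with coefficients `c`. -/
def mev (x y : ι → ℝ) (c : ℝ × ℝ × ℝ) (p : ι) : ℝ := c.1 * x p + c.2.1 * y p + c.2.2

/-- The conjugate functional (position along the line). -/
def mcj (x y : ι → ℝ) (c : ℝ × ℝ × ℝ) (p : ι) : ℝ := -c.2.1 * x p + c.1 * y p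

def mnd (c : ℝ × ℝ × ℝ) : Prop := 0 < c.1 ^ 2 + c.2.1 ^ 2

structure MQ (S : Finset ι) (x y : ι → ℝ) (c : ℝ × ℝ × ℝ) (a b : ι) : Prop where
  ha : a ∈ S
  hb : b ∈ S
  za : mev x y c a = 0
  pb : 0 < mev x y c b
  strip : ∀ p ∈ S, mev x y c p ≤ 0 ∨ mev x y c b ≤ mev x y c p
  ea : ∀ p ∈ S, mev x y c p = 0 → mcj x y c a ≤ mcj x y c p
  eb : ∀ p ∈ S, mev x y c p = mev x y c b → mcj x y c p ≤ mcj x y c b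

def mscale (r : ℝ) (c : ℝ × ℝ × ℝ) : ℝ × ℝ × ℝ := (r * c.1, r * c.2.1, r * c.2.2)

lemma mev_scale (x y : ι → ℝ) (r : ℝ) (c) (p : ι) :
    mev x y (mscale r c) p = r * mev x y c p := by
  simp only [mev, mscale]; ring

lemma mcj_scale (x y : ι → ℝ) (r : ℝ) (c) (p : ι) :
    mcj x y (mscale r c) p = r * mcj x y c p := by
  simp only [mcj, mscale]; ring

lemma mscale_mscale (r s : ℝ) (c) : mscale r (mscale s c) = mscale (r * s) c := by
  simp only [mscale, Prod.mk.injEq]; refine ⟨?_, ?_, ?_⟩ <;> ring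

lemma mnd_scale {r : ℝ} (hr : r ≠ 0) {c} (h : mnd c) : mnd (mscale r c) := by
  have : 0 < r ^ 2 := by positivity
  simp only [mnd, mscale] at *
  nlinarith [mul_pos this h]

/-- `(ev, cj)` are injective coordinates. -/
lemma mcoord_inj {x y : ι → ℝ} {c} (h : mnd c) {p q : ι} (h1 : mev x y c p = mev x y c q)
    (h2 : mcj x y c p = mcj x y c q) : x p = x q ∧ y p = y q := by
  simp only [mnd, mev, mcj] at *
  constructor
  · have : (c.1 ^ 2 + c.2.1 ^ 2) * (x p - x q) = 0 := by linear_combination c.1 * h1 - c.2.1 * h2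
    rcases mul_eq_zero.1 this with h' | h' <;> linarith
  · have : (c.1 ^ 2 + c.2.1 ^ 2) * (y p - y q) = 0 := by linear_combination c.2.1 * h1 + c.1 * h2
    rcases mul_eq_zero.1 this with h' | h' <;> linarith

lemma MQ.scale {S : Finset ι} {x y : ι → ℝ} {c a b} (h : MQ S x y c a b) {r : ℝ} (hr : 0 < r) :
    MQ S x y (mscale r c) a b where
  ha := h.ha
  hb := h.hb
  za := by rw [mev_scale, h.za, mul_zero]
  pb := by rw [mev_scale]; exact mul_pos hr h.pb
  strip := by
    intro p hp
    simp only [mev_scale]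
    rcases h.strip p hp with h' | h'
    · left; exact mul_nonpos_of_nonneg_of_nonpos hr.le h'
    · right; exact mul_le_mul_of_nonneg_left h' hr.le
  ea := by
    intro p hp hz
    simp only [mev_scale, mcj_scale] at *
    refine mul_le_mul_of_nonneg_left (h.ea p hp ?_) hr.le
    rcases mul_eq_zero.1 hz with h' | h'
    · exact absurd h' hr.ne'
    · exact h'
  eb := by
    intro p hp hz
    simp only [mev_scale, mcj_scale] at *
    exact mul_le_mul_of_nonneg_left (h.eb p hp (mul_left_cancel₀ hr.ne' hz)) hr.le

lemma MQ.unique {S : Finset ι} {x y : ι → ℝ} {c a b a' b'} (hc : mnd c)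
    (hinj : ∀ p ∈ S, ∀ q ∈ S, x p = x q → y p = y q → p = q)
    (h : MQ S x y c a b) (h' : MQ S x y c a' b') : a = a' ∧ b = b' := by
  have e1 : mev x y c b = mev x y c b' := by
    have := h.pb
    have := h'.pb
    rcases h.strip b' h'.hb with h1 | h1 <;> rcases h'.strip b h.hb with h2 | h2 <;> linarith
  constructor
  · have := mcoord_inj hc (h.za.trans h'.za.symm)
      (le_antisymm (h.ea a' h'.ha h'.za) (h'.ea a h.ha h.za))
    exact hinj _ h.ha _ h'.ha this.1 this.2
  · have := mcoord_inj hc e1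
      (le_antisymm (h'.eb b h.hb e1) (h.eb b' h'.hb e1.symm))
    exact hinj _ h.hb _ h'.hb this.1 this.2

lemma mprop {x y : ι → ℝ} {c c'} (h : mnd c) (h' : mnd c') {p q : ι}
    (hpq : ¬ (x p = x q ∧ y p = y q))
    (h1 : mev x y c p = 0) (h2 : mev x y c q = 0) (h3 : mev x y c' p = 0) (h4 : mev x y c' q = 0) :
    ∃ r : ℝ, r ≠ 0 ∧ c = mscale r c' := by
  obtain ⟨a, b, e⟩ := c
  obtain ⟨a', b', e'⟩ := c'
  simp only [mnd, mev, mscale, Prod.mk.injEq] at *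
  have hx : (a * b' - b * a') * (x p - x q) = 0 := by
    linear_combination b' * (h1 - h2) - b * (h3 - h4)
  have hy : (a * b' - b * a') * (y p - y q) = 0 := by
    linear_combination a * (h3 - h4) - a' * (h1 - h2)
  have hz : a * b' - b * a' = 0 := by
    by_contra hne
    apply hpq
    constructor
    · have := (mul_eq_zero.1 hx).resolve_left hne; linarith
    · have := (mul_eq_zero.1 hy).resolve_left hne; linarith
  have hn : a' ^ 2 + b' ^ 2 ≠ 0 := h'.ne'
  have ea : a = (a * a' + b * b') / (a' ^ 2 + b' ^ 2) * a' := by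
    field_simp
    linear_combination b' * hz
  have eb : b = (a * a' + b * b') / (a' ^ 2 + b' ^ 2) * b' := by
    field_simp
    linear_combination -a' * hz
  set r := (a * a' + b * b') / (a' ^ 2 + b' ^ 2) with hr
  refine ⟨r, ?_, ea, eb, ?_⟩
  · intro h0
    rw [h0] at ea eb
    rw [ea, eb] at h
    norm_num at h
  · linear_combination h1 - r * h3 - x p * ea - y p * eb

/-- Key lemma: consecutive points arise from an oriented spanned line. -/
lemma mkey {S : Finset ι} {x y : ι → ℝ} {a b : ι} (ha : a ∈ S) (hb : b ∈ S)
    (hab : ¬ (x a = x b ∧ y a = y b))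
    (hcons : ∀ p ∈ S, (x b - x a) * (y p - y a) - (y b - y a) * (x p - x a) = 0 →
      (x b - x a) * (x p - x a) + (y b - y a) * (y p - y a) ≤ 0 ∨
      (x b - x a) ^ 2 + (y b - y a) ^ 2 ≤ (x b - x a) * (x p - x a) + (y b - y a) * (y p - y a))
    (hnc : ∃ p ∈ S, (x b - x a) * (y p - y a) - (y b - y a) * (x p - x a) ≠ 0) :
    ∃ c, mnd c ∧ (∃ p ∈ S, ∃ q ∈ S, p ≠ q ∧ mev x y c p = 0 ∧ mev x y c q = 0) ∧
      (MQ S x y c a b ∨ MQ S x y c b a) := by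
  classical
  set u := x b - x a with hu
  set v := y b - y a with hv
  set D := u ^ 2 + v ^ 2 with hD
  have hDpos : 0 < D := by
    rcases not_and_or.1 hab with h | h
    · have : u ≠ 0 := by intro h'; apply h; linarith
      positivity
    · have : v ≠ 0 := by intro h'; apply h; linarith
      positivity
  set X : ι → ℝ := fun p => u * (x p - x a) + v * (y p - y a) with hX
  set Y : ι → ℝ := fun p => u * (y p - y a) - v * (x p - x a) with hY
  have hXa : X a = 0 := by simp [hX]
  have hYa : Y a = 0 := by simp [hY]
  have hXb : X b = D := by simp only [hX, hD, ← hu, ← hv]; ring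
  have hYb : Y b = 0 := by simp only [hY, ← hu, ← hv]; ring
  obtain ⟨p0, hp0, hp0'⟩ := hnc
  obtain ⟨w, hw, hwmax⟩ := Finset.exists_max_image (S.filter (fun p => Y p ≠ 0))
    (fun p => max (X p / Y p) ((X p - D) / Y p)) ⟨p0, by simp [hp0, hY]; exact hp0'⟩
  rw [Finset.mem_filter] at hw
  obtain ⟨hwS, hwY⟩ := hw
  obtain ⟨M, hM⟩ : ∃ M, M = max (X w / Y w) ((X w - D) / Y w) := ⟨_, rfl⟩
  have pos : ∀ p ∈ S, 0 < Y p → X p - M * Y p ≤ 0 := by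
    intro p hp h
    have := (le_max_left _ _).trans (hwmax p (by simp [hp, h.ne']))
    rw [← hM, div_le_iff₀ h] at this
    linarith
  have neg : ∀ p ∈ S, Y p < 0 → D ≤ X p - M * Y p := by
    intro p hp h
    have := (le_max_right _ _).trans (hwmax p (by simp [hp, h.ne]))
    rw [← hM, div_le_iff_of_neg h] at this
    linarith
  have zer : ∀ p ∈ S, Y p = 0 → X p ≤ 0 ∨ D ≤ X p := fun p hp h => hcons p hp h
  have strip : ∀ p ∈ S, X p - M * Y p ≤ 0 ∨ D ≤ X p - M * Y p := by
    intro p hp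
    rcases lt_trichotomy (Y p) 0 with h | h | h
    · exact Or.inr (neg p hp h)
    · rw [h, mul_zero, sub_zero]; exact zer p hp h
    · exact Or.inl (pos p hp h)
  have z0 : ∀ p ∈ S, X p - M * Y p = 0 → 0 ≤ Y p := by
    intro p hp h
    by_contra h'
    have := neg p hp (not_le.1 h')
    linarith
  have zD : ∀ p ∈ S, X p - M * Y p = D → Y p ≤ 0 := by
    intro p hp h
    by_contra h'
    have := pos p hp (not_le.1 h')
    linarith
  have hnd : 0 < (u + M * v) ^ 2 + (v - M * u) ^ 2 := by
    have : (u + M * v) ^ 2 + (v - M * u) ^ 2 = (1 + M ^ 2) * D := by rw [hD]; ring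
    rw [this]; positivity
  rcases max_choice (X w / Y w) ((X w - D) / Y w) with hm | hm
  · rw [hm, eq_div_iff hwY] at hM
    let c : ℝ × ℝ × ℝ := (u + M * v, v - M * u, -(u + M * v) * x a - (v - M * u) * y a)
    have hev : ∀ p, mev x y c p = X p - M * Y p := by
      intro p; simp only [mev, c, hX, hY]; ring
    have hcj : ∀ p, mcj x y c p = mcj x y c a + (Y p + M * X p) := by
      intro p; simp only [mcj, c, hX, hY]; ring
    refine ⟨c, hnd, ⟨a, ha, w, hwS, ?_, ?_, ?_⟩, Or.inl ⟨ha, hb, ?_, ?_, ?_, ?_, ?_⟩⟩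
    · rintro rfl; exact hwY hYa
    · rw [hev, hXa, hYa]; ring
    · rw [hev]; linarith
    · rw [hev, hXa, hYa]; ring
    · rw [hev, hXb, hYb]; linarith
    · intro p hp
      rw [hev, hev, hXb, hYb, mul_zero, sub_zero]; exact strip p hp
    · intro p hp h
      rw [hev] at h
      rw [hcj p]
      have := z0 p hp h
      have e : X p = M * Y p := by linarith
      rw [e]
      nlinarith [mul_nonneg (sq_nonneg M) this]
    · intro p hp h
      rw [hev, hev, hXb, hYb, mul_zero, sub_zero] at h
      rw [hcj p, hcj b, hXb, hYb]
      have := zD p hp h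
      have e : X p = M * Y p + D := by linarith
      rw [e]
      nlinarith [mul_nonneg (sq_nonneg M) (neg_nonneg.2 this)]
  · rw [hm, eq_div_iff hwY] at hM
    let c : ℝ × ℝ × ℝ := (-(u + M * v), -(v - M * u), D + (u + M * v) * x a + (v - M * u) * y a)
    have hev : ∀ p, mev x y c p = D - (X p - M * Y p) := by
      intro p; simp only [mev, c, hX, hY]; ring
    have hcj : ∀ p, mcj x y c p = mcj x y c a - (Y p + M * X p) := by
      intro p; simp only [mcj, c, hX, hY]; ring
    refine ⟨c, ?_, ⟨b, hb, w, hwS, ?_, ?_, ?_⟩, Or.inr ⟨hb, ha, ?_, ?_, ?_, ?_, ?_⟩⟩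
    · simp only [mnd, c, neg_sq]; exact hnd
    · rintro rfl; exact hwY hYb
    · rw [hev, hXb, hYb]; ring
    · rw [hev]; linarith
    · rw [hev, hXb, hYb]; ring
    · rw [hev, hXa, hYa]; linarith
    · intro p hp
      rw [hev, hev, hXa, hYa]
      rcases strip p hp with h | h
      · right; linarith
      · left; linarith
    · intro p hp h
      rw [hev] at h
      rw [hcj p, hcj b, hXb, hYb]
      have := zD p hp (by linarith)
      have e : X p = M * Y p + D := by linarith
      rw [e]
      nlinarith [mul_nonneg (sq_nonneg M) (neg_nonneg.2 this)]
    · intro p hp h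
      rw [hev, hev, hXa, hYa] at h
      rw [hcj p]
      have h' : X p - M * Y p = 0 := by linarith
      have := z0 p hp h'
      have e : X p = M * Y p := by linarith
      rw [e]
      nlinarith [mul_nonneg (sq_nonneg M) this]

/-- Gift wrapping step. -/
lemma mwrap {S : Finset ι} {F K : ι → ℝ} (hF : ∀ p ∈ S, F p ≤ 0)
    (hK : ∀ p ∈ S, F p = 0 → K p ≤ 0) (hne : ∃ p ∈ S, F p ≠ 0) :
    ∃ m : ℝ, (∀ p ∈ S, K p + m * F p ≤ 0) ∧ ∃ q ∈ S, F q < 0 ∧ K q + m * F q = 0 := by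
  classical
  obtain ⟨p0, hp0, hp0'⟩ := hne
  obtain ⟨w, hw, hwmax⟩ := Finset.exists_max_image (S.filter (fun p => F p ≠ 0))
    (fun p => K p / (-F p)) ⟨p0, by simp [hp0, hp0']⟩
  rw [Finset.mem_filter] at hw
  have hwF := lt_of_le_of_ne (hF w hw.1) hw.2
  refine ⟨K w / (-F w), ?_, w, hw.1, hwF, ?_⟩
  · intro p hp
    by_cases h : F p = 0
    · rw [h, mul_zero, add_zero]; exact hK p hp h
    · have h1 := hwmax p (by simp [hp, h])
      have h2 := lt_of_le_of_ne (hF p hp) h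
      rw [div_le_iff₀ (by linarith)] at h1
      linarith
  · have := hw.2
    field_simp
    ring

open Classical in
/-- traces of spanned lines -/
noncomputable def mtr (S : Finset ι) (x y : ι → ℝ) : Finset (Finset ι) :=
  S.powerset.filter (fun T => 2 ≤ T.card ∧ ∃ c, mnd c ∧ T = S.filter (fun p => mev x y c p = 0))

open Classical in
lemma mtr_of {S : Finset ι} {x y : ι → ℝ} {c} (hc : mnd c) {p q : ι} (hp : p ∈ S) (hq : q ∈ S)
    (hpq : p ≠ q) (h1 : mev x y c p = 0) (h2 : mev x y c q = 0) :
    S.filter (fun p => mev x y c p = 0) ∈ mtr S x y := by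
  simp only [mtr, Finset.mem_filter, Finset.mem_powerset]
  refine ⟨Finset.filter_subset _ _, ?_, c, hc, rfl⟩
  exact Finset.one_lt_card.2 ⟨p, by simp [hp, h1], q, by simp [hq, h2], hpq⟩

open Classical in
/-- three hull edges -/
lemma mhull {S : Finset ι} {x y : ι → ℝ}
    (hnc : ∀ c, mnd c → ∃ p ∈ S, mev x y c p ≠ 0) :
    ∃ c1 c2 c3, (∀ c ∈ [c1, c2, c3], mnd c ∧ S.filter (fun p => mev x y c p = 0) ∈ mtr S x y ∧
        ∀ p ∈ S, mev x y c p ≤ 0) ∧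
      S.filter (fun p => mev x y c1 p = 0) ≠ S.filter (fun p => mev x y c2 p = 0) ∧
      S.filter (fun p => mev x y c1 p = 0) ≠ S.filter (fun p => mev x y c3 p = 0) ∧
      S.filter (fun p => mev x y c2 p = 0) ≠ S.filter (fun p => mev x y c3 p = 0) := by
  -- one wrapping step
  have step : ∀ (s : ℝ), s ^ 2 = 1 → ∀ c, mnd c → (∀ p ∈ S, mev x y c p ≤ 0) →
      (∃ p ∈ S, mev x y c p = 0) →
      ∃ b ∈ S, mev x y c b = 0 ∧ (∀ p ∈ S, mev x y c p = 0 → s * mcj x y c p ≤ s * mcj x y c b) ∧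
      ∃ c', mnd c' ∧ (∀ p ∈ S, mev x y c' p ≤ 0) ∧ mev x y c' b = 0 ∧
        (∃ q ∈ S, mev x y c q < 0 ∧ mev x y c' q = 0) ∧
        (∀ p, mev x y c p = 0 → mev x y c' p = s * mcj x y c p - s * mcj x y c b) := by
    intro s hs c hc hle ⟨p0, hp0, hp0'⟩
    obtain ⟨b, hb, hbmax⟩ := Finset.exists_max_image (S.filter (fun p => mev x y c p = 0))
      (fun p => s * mcj x y c p) ⟨p0, by simp [hp0, hp0']⟩
    rw [Finset.mem_filter] at hb
    have hbm : ∀ p ∈ S, mev x y c p = 0 → s * mcj x y c p ≤ s * mcj x y c b :=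
      fun p hp h => hbmax p (by simp [hp, h])
    refine ⟨b, hb.1, hb.2, hbm, ?_⟩
    obtain ⟨m, hm, q, hq, hq1, hq2⟩ := mwrap (S := S) (F := mev x y c)
      (K := fun p => s * mcj x y c p - s * mcj x y c b) hle
      (fun p hp h => by have := hbm p hp h; linarith) (hnc c hc)
    have hev : ∀ p, mev x y (-s * c.2.1 + m * c.1, s * c.1 + m * c.2.1,
        m * c.2.2 - s * mcj x y c b) p
        = s * mcj x y c p - s * mcj x y c b + m * mev x y c p := by
      intro p
      simp only [mev, mcj]; ring
    refine ⟨_, ?_, fun p hp => (hev p).trans_le (hm p hp), ?_, ⟨q, hq, hq1, ?_⟩, ?_⟩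
    · simp only [mnd] at *
      have : (-s * c.2.1 + m * c.1) ^ 2 + (s * c.1 + m * c.2.1) ^ 2
          = (s ^ 2 + m ^ 2) * (c.1 ^ 2 + c.2.1 ^ 2) := by ring
      rw [this, hs]; positivity
    · rw [hev, hb.2]; ring
    · rw [hev]; exact hq2
    · intro p hp; rw [hev, hp]; ring
  -- initial supporting line
  obtain ⟨i0, hi0, -⟩ := hnc (1, 0, 0) (by simp [mnd])
  obtain ⟨i, hi, himax⟩ := Finset.exists_max_image S x ⟨i0, hi0⟩
  obtain ⟨b0, hb0, hb0z, -, c1, hc1, hle1, hb1, ⟨q1, hq1, hq1n, hq1z⟩, -⟩ :=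
    step 1 (by norm_num) (1, 0, -x i) (by simp [mnd])
      (fun p hp => by have := himax p hp; simp only [mev]; linarith)
      ⟨i, hi, by simp [mev]⟩
  have hne1 : b0 ≠ q1 := by rintro rfl; linarith
  obtain ⟨b, hb, hbz, hbm, c2, hc2, hle2, hb2, ⟨q2, hq2, hq2n, hq2z⟩, hf2⟩ :=
    step 1 (by norm_num) c1 hc1 hle1 ⟨b0, hb0, hb1⟩
  obtain ⟨a, ha, haz, ham, c3, hc3, hle3, ha3, ⟨q3, hq3, hq3n, hq3z⟩, hf3⟩ :=
    step (-1) (by norm_num) c1 hc1 hle1 ⟨b0, hb0, hb1⟩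
  have hlt : mcj x y c1 a < mcj x y c1 b := by
    have h1 := hbm _ hb0 hb1
    have h2 := hbm _ hq1 hq1z
    have h3 := ham _ hb0 hb1
    have h4 := ham _ hq1 hq1z
    by_contra hcon
    have h5 : mcj x y c1 b0 = mcj x y c1 q1 := by linarith
    have h6 := mcoord_inj hc1 (hb1.trans hq1z.symm) h5
    simp only [mev] at hb0z hq1n
    rw [h6.1] at hb0z
    linarith
  refine ⟨c1, c2, c3, ?_, ?_, ?_, ?_⟩
  · intro c hc
    simp only [List.mem_cons, List.not_mem_nil, or_false] at hc
    rcases hc with rfl | rfl | rfl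
    · exact ⟨hc1, mtr_of hc1 hb0 hq1 hne1 hb1 hq1z, hle1⟩
    · exact ⟨hc2, mtr_of hc2 hb hq2 (by rintro rfl; linarith) hb2 hq2z, hle2⟩
    · exact ⟨hc3, mtr_of hc3 ha hq3 (by rintro rfl; linarith) ha3 hq3z, hle3⟩
  · intro h
    have : q2 ∈ S.filter (fun p => mev x y c1 p = 0) := by rw [h]; simp [hq2, hq2z]
    have := (Finset.mem_filter.1 this).2
    linarith
  · intro h
    have : q3 ∈ S.filter (fun p => mev x y c1 p = 0) := by rw [h]; simp [hq3, hq3z]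
    have := (Finset.mem_filter.1 this).2
    linarith
  · intro h
    have : a ∈ S.filter (fun p => mev x y c2 p = 0) := by rw [h]; simp [ha, ha3]
    have := (Finset.mem_filter.1 this).2
    rw [hf2 a haz] at this
    linarith

open Classical in
/-- Core inequality. -/
theorem mcore {S : Finset ι} {x y : ι → ℝ}
    (hinj : ∀ p ∈ S, ∀ q ∈ S, x p = x q → y p = y q → p = q)
    (hnc : ∀ c, mnd c → ∃ p ∈ S, mev x y c p ≠ 0) :
    3 + ∑ T ∈ mtr S x y, (T.card - 1) ≤ 2 * (mtr S x y).card := by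
  -- canonical coefficients
  have hex : ∀ T : Finset ι, ∃ c, T ∈ mtr S x y →
      mnd c ∧ T = S.filter (fun p => mev x y c p = 0) := by
    intro T
    by_cases hT : T ∈ mtr S x y
    · simp only [mtr, Finset.mem_filter] at hT
      obtain ⟨-, -, c, hc⟩ := hT
      exact ⟨c, fun _ => hc⟩
    · exact ⟨(0, 0, 0), fun h => absurd h hT⟩
  choose cf hcf using hex
  have hcard : ∀ T ∈ mtr S x y, 2 ≤ T.card := by
    intro T hT; simp only [mtr, Finset.mem_filter] at hT; exact hT.2.1
  have hmem : ∀ T ∈ mtr S x y, ∀ p, p ∈ T ↔ p ∈ S ∧ mev x y (cf T) p = 0 := by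
    intro T hT p
    conv_lhs => rw [(hcf T hT).2]
    simp
  let sg : Bool → ℝ := fun s => if s then 1 else -1
  -- any functional with a spanned zero set is a positive multiple of a canonical one
  have hcan : ∀ c, mnd c → S.filter (fun p => mev x y c p = 0) ∈ mtr S x y →
      ∃ s : Bool, ∃ r : ℝ, 0 < r ∧
        mscale (sg s) (cf (S.filter (fun p => mev x y c p = 0))) = mscale r c := by
    intro c hc hT
    set T := S.filter (fun p => mev x y c p = 0) with hTd
    obtain ⟨p, hp, q, hq, hpq⟩ := Finset.one_lt_card.1 (hcard T hT)
    have hp' := (hmem T hT p).1 hp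
    have hq' := (hmem T hT q).1 hq
    rw [hTd, Finset.mem_filter] at hp hq
    obtain ⟨r, hr, hrc⟩ := mprop (hcf T hT).1 hc
      (fun h => hpq (hinj p hp.1 q hq.1 h.1 h.2)) hp'.2 hq'.2 hp.2 hq.2
    rcases lt_or_gt_of_ne hr with h | h
    · refine ⟨false, -r, by linarith, ?_⟩
      rw [hrc, mscale_mscale]; simp [sg]
    · refine ⟨true, r, h, ?_⟩
      rw [hrc, mscale_mscale]; simp [sg]
  -- domain
  let g : Finset ι → ι → ℝ := fun T p => mcj x y (cf T) p
  have hsucc : ∀ T ∈ mtr S x y, ∃ z ∈ T, ∀ p ∈ T, g T p ≤ g T z := by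
    intro T hT
    have : T.Nonempty := Finset.card_pos.1 (by have := hcard T hT; omega)
    exact Finset.exists_max_image T (g T) this
  have hginj : ∀ T ∈ mtr S x y, ∀ p ∈ T, ∀ q ∈ T, g T p = g T q → p = q := by
    intro T hT p hp q hq h
    rw [hmem T hT] at hp hq
    have := mcoord_inj (hcf T hT).1 (hp.2.trans hq.2.symm) h
    exact hinj _ hp.1 _ hq.1 this.1 this.2
  let Dm : Finset (Σ _ : Finset ι, ι) :=
    (mtr S x y).sigma (fun T => T.filter (fun a => ∃ p ∈ T, g T a < g T p))
  have hDcard : Dm.card = ∑ T ∈ mtr S x y, (T.card - 1) := by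
    rw [Finset.card_sigma]
    refine Finset.sum_congr rfl fun T hT => ?_
    obtain ⟨z, hz, hzm⟩ := hsucc T hT
    have : T.filter (fun a => ∃ p ∈ T, g T a < g T p) = T.erase z := by
      ext a
      simp only [Finset.mem_filter, Finset.mem_erase]
      constructor
      · rintro ⟨haT, p, hp, hlt⟩
        refine ⟨?_, haT⟩
        rintro rfl
        exact absurd (hzm p hp) (not_le.2 hlt)
      · rintro ⟨hne, haT⟩
        refine ⟨haT, z, hz, lt_of_le_of_ne (hzm a haT) ?_⟩
        intro h; exact hne (hginj T hT _ haT _ hz h)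
    rw [this, Finset.card_erase_of_mem hz]
  -- for each element of the domain a target
  have htar : ∀ d : (Σ _ : Finset ι, ι), ∃ t : Finset ι × Bool, d ∈ Dm →
      t.1 ∈ mtr S x y ∧ ∃ b ∈ d.1, g d.1 d.2 < g d.1 b ∧
        (∀ p ∈ d.1, g d.1 p ≤ g d.1 d.2 ∨ g d.1 b ≤ g d.1 p) ∧
        (MQ S x y (mscale (sg t.2) (cf t.1)) d.2 b ∨ MQ S x y (mscale (sg t.2) (cf t.1)) b d.2) := by
    rintro ⟨T, a⟩
    by_cases hd : (⟨T, a⟩ : Σ _ : Finset ι, ι) ∈ Dm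
    swap
    · exact ⟨(∅, true), fun h => absurd h hd⟩
    have hd' := hd
    simp only [Dm, Finset.mem_sigma, Finset.mem_filter] at hd'
    obtain ⟨hT, haT, p0, hp0, hp0lt⟩ := hd'
    obtain ⟨b, hb, hbmin⟩ := Finset.exists_min_image (T.filter (fun p => g T a < g T p)) (g T)
      ⟨p0, by simp [hp0, hp0lt]⟩
    rw [Finset.mem_filter] at hb
    have hstr : ∀ p ∈ T, g T p ≤ g T a ∨ g T b ≤ g T p := by
      intro p hp
      by_cases h : g T a < g T p
      · right; exact hbmin p (by simp [hp, h])
      · left; exact not_lt.1 h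
    have haS := (hmem T hT a).1 haT
    have hbS := (hmem T hT b).1 hb.1
    have hnd := (hcf T hT).1
    -- direction
    obtain ⟨s, hs, hu, hv⟩ : ∃ s : ℝ, 0 < s ∧ x b - x a = s * (-(cf T).2.1) ∧
        y b - y a = s * (cf T).1 := by
      have hn : (cf T).1 ^ 2 + (cf T).2.1 ^ 2 ≠ 0 := ne_of_gt hnd
      have h1 := haS.2
      have h2 := hbS.2
      refine ⟨(g T b - g T a) / ((cf T).1 ^ 2 + (cf T).2.1 ^ 2),
        div_pos (by linarith [hb.2]) hnd, ?_, ?_⟩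
      · field_simp
        simp only [g, mcj, mev] at *
        linear_combination (cf T).1 * (h2 - h1)
      · field_simp
        simp only [g, mcj, mev] at *
        linear_combination (cf T).2.1 * (h2 - h1)
    have hXg : ∀ p, (x b - x a) * (x p - x a) + (y b - y a) * (y p - y a)
        = s * (g T p - g T a) := by
      intro p; rw [hu, hv]; simp only [g, mcj]; ring
    have hYg : ∀ p, (x b - x a) * (y p - y a) - (y b - y a) * (x p - x a)
        = -s * mev x y (cf T) p := by
      intro p; rw [hu, hv]
      have h1 := haS.2
      simp only [mev] at *
      linear_combination s * h1
    have hab : ¬ (x a = x b ∧ y a = y b) := by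
      rintro ⟨h1, h2⟩
      have := hb.2
      simp only [g, mcj] at this
      rw [h1, h2] at this
      exact lt_irrefl _ this
    obtain ⟨c, hc, ⟨p, hp, q, hq, hpq, hpz, hqz⟩, hQ⟩ := mkey haS.1 hbS.1 hab
      (by
        intro p hp h
        rw [hYg] at h
        have hpT : p ∈ T := by
          rw [hmem T hT]
          refine ⟨hp, (mul_eq_zero.1 h).resolve_left (by linarith)⟩
        have hD := hXg b
        rw [hXg]
        have e : (x b - x a) ^ 2 + (y b - y a) ^ 2 = s * (g T b - g T a) := by
          rw [← hD]; ring
        rw [e]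
        rcases hstr p hpT with h' | h'
        · left; exact mul_nonpos_of_nonneg_of_nonpos hs.le (by linarith)
        · right; exact mul_le_mul_of_nonneg_left (by linarith) hs.le)
      (by
        obtain ⟨p, hp, hpne⟩ := hnc (cf T) hnd
        refine ⟨p, hp, ?_⟩
        rw [hYg]
        exact mul_ne_zero (by linarith) hpne)
    have hT' := mtr_of hc hp hq hpq hpz hqz
    obtain ⟨sb, r, hr, hrc⟩ := hcan c hc hT'
    have hQ2 := hQ.imp (fun h => h.scale hr) (fun h => h.scale hr)
    rw [← hrc] at hQ2
    exact ⟨(_, sb), fun _ => ⟨hT', b, hb.1, hb.2, hstr, hQ2⟩⟩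
  choose tar htar using htar
  -- injectivity
  have hsg : ∀ s, sg s ≠ 0 := by intro s; cases s <;> simp [sg]
  have hline : ∀ T ∈ mtr S x y, ∀ T' ∈ mtr S x y, ∀ p q, p ≠ q → p ∈ T → q ∈ T → p ∈ T' →
      q ∈ T' → T = T' := by
    intro T hT T' hT' p q hpq h1 h2 h3 h4
    rw [hmem T hT] at h1 h2
    rw [hmem T' hT'] at h3 h4
    obtain ⟨r, hr, hrc⟩ := mprop (hcf T hT).1 (hcf T' hT').1
      (fun h => hpq (hinj p h1.1 q h2.1 h.1 h.2)) h1.2 h2.2 h3.2 h4.2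
    ext z
    rw [hmem T hT, hmem T' hT', hrc, mev_scale]
    simp [hr]
  have hinjOn : Set.InjOn tar (Dm : Set (Σ _ : Finset ι, ι)) := by
    rintro ⟨T, a⟩ hd ⟨T', a'⟩ hd' heq
    obtain ⟨ht, b, hb, hlt, hstr, hQ⟩ := htar _ hd
    obtain ⟨ht', b', hb', hlt', hstr', hQ'⟩ := htar _ hd'
    have hd1 : T ∈ mtr S x y ∧ a ∈ T := by
      have := Finset.mem_coe.1 hd
      simp only [Dm, Finset.mem_sigma, Finset.mem_filter] at this
      exact ⟨this.1, this.2.1⟩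
    have hd2 : T' ∈ mtr S x y ∧ a' ∈ T' := by
      have := Finset.mem_coe.1 hd'
      simp only [Dm, Finset.mem_sigma, Finset.mem_filter] at this
      exact ⟨this.1, this.2.1⟩
    rw [← heq] at hQ'
    have hcnd := mnd_scale (hsg (tar ⟨T, a⟩).2) (hcf _ ht).1
    simp only at hb hb' hlt hlt' hQ hQ'
    have hne : a ≠ b := by rintro rfl; exact lt_irrefl _ hlt
    have hcases : (a = a' ∧ b = b') ∨ (a = b' ∧ b = a') := by
      rcases hQ with h | h <;> rcases hQ' with h' | h'
      · exact Or.inl (h.unique hcnd hinj h')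
      · exact Or.inr (h.unique hcnd hinj h')
      · exact Or.inr (h.unique hcnd hinj h').symm
      · exact Or.inl (h.unique hcnd hinj h').symm
    rcases hcases with ⟨rfl, rfl⟩ | ⟨rfl, rfl⟩
    · have := hline T hd1.1 T' hd2.1 a b hne hd1.2 hb hd2.2 hb'
      rw [this]
    · have := hline T hd1.1 T' hd2.1 a b hne hd1.2 hb hb' hd2.2
      subst this
      exact absurd hlt (not_lt.2 hlt'.le)
  -- hull edges are missed
  let All : Finset (Finset ι × Bool) := (mtr S x y) ×ˢ Finset.univ
  let H : Finset (Finset ι × Bool) :=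
    All.filter (fun t => ∀ p ∈ S, mev x y (mscale (sg t.2) (cf t.1)) p ≤ 0)
  have hH : 3 ≤ H.card := by
    obtain ⟨c1, c2, c3, hc, h12, h13, h23⟩ := mhull hnc
    have hh : ∀ c, c ∈ [c1, c2, c3] → ∃ s, (S.filter (fun p => mev x y c p = 0), s) ∈ H := by
      intro c hcm
      obtain ⟨hcn, hcT, hcl⟩ := hc c hcm
      obtain ⟨s, r, hr, hrc⟩ := hcan c hcn hcT
      refine ⟨s, ?_⟩
      simp only [H, All, Finset.mem_filter, Finset.mem_product, Finset.mem_univ, and_true]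
      refine ⟨hcT, fun p hp => ?_⟩
      rw [hrc, mev_scale]
      exact mul_nonpos_of_nonneg_of_nonpos hr.le (hcl p hp)
    obtain ⟨s1, hs1⟩ := hh c1 (by simp)
    obtain ⟨s2, hs2⟩ := hh c2 (by simp)
    obtain ⟨s3, hs3⟩ := hh c3 (by simp)
    have : 2 < H.card := Finset.two_lt_card.2 ⟨_, hs1, _, hs2, _, hs3,
      fun h => h12 (congrArg Prod.fst h), fun h => h13 (congrArg Prod.fst h),
      fun h => h23 (congrArg Prod.fst h)⟩
    exact this
  have hdisj : Disjoint (Dm.image tar) H := by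
    rw [Finset.disjoint_left]
    intro t ht htH
    obtain ⟨d, hd, rfl⟩ := Finset.mem_image.1 ht
    obtain ⟨-, b, hb, -, -, hQ⟩ := htar d hd
    have hle := (Finset.mem_filter.1 htH).2
    rcases hQ with h | h
    · exact absurd (hle _ h.hb) (not_le.2 h.pb)
    · exact absurd (hle _ h.hb) (not_le.2 h.pb)
  have hsub : Dm.image tar ∪ H ⊆ All := by
    apply Finset.union_subset
    · intro t ht
      obtain ⟨d, hd, rfl⟩ := Finset.mem_image.1 ht
      simp only [All, Finset.mem_product, Finset.mem_univ, and_true]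
      exact (htar d hd).1
    · exact Finset.filter_subset _ _
  have h1 := Finset.card_le_card hsub
  rw [Finset.card_union_of_disjoint hdisj, Finset.card_image_of_injOn hinjOn, hDcard] at h1
  have h2 : All.card = (mtr S x y).card * 2 := by simp [All, Finset.card_product]
  omega

open Classical in
theorem mcore' {S : Finset ι} {x y : ι → ℝ}
    (hinj : ∀ p ∈ S, ∀ q ∈ S, x p = x q → y p = y q → p = q)
    (hnc : ∀ c, mnd c → ∃ p ∈ S, mev x y c p ≠ 0) :
    3 + ∑ k ∈ Finset.Icc 4 S.card, (k - 3) * ((mtr S x y).filter (fun T => T.card = k)).card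
      ≤ ((mtr S x y).filter (fun T => T.card = 2)).card := by
  have h := mcore hinj hnc
  have hcard : ∀ T ∈ mtr S x y, 2 ≤ T.card ∧ T.card ≤ S.card := by
    intro T hT; simp only [mtr, Finset.mem_filter, Finset.mem_powerset] at hT
    exact ⟨hT.2.1, Finset.card_le_card hT.1⟩
  have h1 : ∑ k ∈ Finset.Icc 4 S.card,
      (k - 3) * ((mtr S x y).filter (fun T => T.card = k)).card
      = ∑ T ∈ mtr S x y, (T.card - 3) := by
    have : ∀ k ∈ Finset.Icc 4 S.card,
      (k - 3) * ((mtr S x y).filter (fun T => T.card = k)).card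
       = ∑ T ∈ mtr S x y, if T.card = k then (T.card - 3) else 0 := by
      intro k _
      rw [← Finset.sum_filter, Finset.sum_congr rfl
        (g := fun _ => k - 3) (fun T hT => by rw [(Finset.mem_filter.1 hT).2])]
      simp [mul_comm]
    rw [Finset.sum_congr rfl this, Finset.sum_comm]
    refine Finset.sum_congr rfl fun T hT => ?_
    rw [Finset.sum_ite_eq]
    have := hcard T hT
    split_ifs with h
    · rfl
    · rw [Finset.mem_Icc] at h; omega
  have h2 : ∑ T ∈ mtr S x y, (T.card - 1) + ((mtr S x y).filter (fun T => T.card = 2)).card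
      = 2 * (mtr S x y).card + ∑ T ∈ mtr S x y, (T.card - 3) := by
    rw [Finset.card_filter, ← Finset.sum_add_distrib, mul_comm, ← smul_eq_mul,
      ← Finset.sum_const, ← Finset.sum_add_distrib]
    refine Finset.sum_congr rfl fun T hT => ?_
    have := hcard T hT
    split_ifs <;> omega
  omega

end MelchiorCore

section MelchiorBridge

lemma isProjLine_iff (L : Set RP2) : IsProjLine L ↔ ∃ n : Fin 3 → ℝ, n ≠ 0 ∧
    L = {p : RP2 | n 0 * p.rep 0 + n 1 * p.rep 1 + n 2 * p.rep 2 = 0} := by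
  constructor
  · rintro ⟨W, hW, rfl⟩
    have hlt : W < ⊤ := by
      rw [lt_top_iff_ne_top]
      rintro rfl
      simp at hW
    obtain ⟨f, hf0, hf⟩ := W.exists_le_ker_of_lt_top hlt
    have hk := Module.Dual.finrank_ker_add_one_of_ne_zero (f := f) hf0
    have hWk : W = LinearMap.ker f := by
      apply Submodule.eq_of_le_of_finrank_eq hf
      simp at hk
      omega
    have hfv : ∀ v : Fin 3 → ℝ, f v = f (Pi.single 0 1) * v 0 + f (Pi.single 1 1) * v 1
        + f (Pi.single 2 1) * v 2 := by
      intro v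
      have hv : v = v 0 • Pi.single 0 1 + v 1 • Pi.single 1 1 + v 2 • Pi.single 2 1 := by
        ext i
        fin_cases i <;> simp [Pi.single_apply]
      conv_lhs => rw [hv]
      simp only [map_add, map_smul, smul_eq_mul]
      ring
    refine ⟨fun i => f (Pi.single i 1), ?_, ?_⟩
    · intro h
      apply hf0
      ext v
      have h' : ∀ i, f (Pi.single i 1) = 0 := fun i => congrFun h i
      simp [h']
    · ext p
      simp only [Set.mem_ofPred_eq]
      rw [← hfv, Projectivization.submodule_eq, Submodule.span_singleton_le_iff_mem, hWk,
        LinearMap.mem_ker]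
  · rintro ⟨n, hn, rfl⟩
    let f : Module.Dual ℝ (Fin 3 → ℝ) :=
      n 0 • LinearMap.proj 0 + n 1 • LinearMap.proj 1 + n 2 • LinearMap.proj 2
    have hfv : ∀ v, f v = n 0 * v 0 + n 1 * v 1 + n 2 * v 2 := by intro v; simp [f]
    have hf0 : f ≠ 0 := by
      intro h
      apply hn
      have h' : ∀ v : Fin 3 → ℝ, n 0 * v 0 + n 1 * v 1 + n 2 * v 2 = 0 := by
        intro v; rw [← hfv, h]; rfl
      ext i
      have := h' (Pi.single i 1)
      fin_cases i <;> simpa [Pi.single_apply] using this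
    refine ⟨LinearMap.ker f, ?_, ?_⟩
    · have hk := Module.Dual.finrank_ker_add_one_of_ne_zero (f := f) hf0
      simp at hk
      omega
    · ext p
      simp only [Set.mem_ofPred_eq]
      rw [← hfv, Projectivization.submodule_eq, Submodule.span_singleton_le_iff_mem,
        LinearMap.mem_ker]

lemma exists_affine (P : Set RP2) (hfin : P.Finite) :
    ∃ t : ℝ, ∀ p ∈ P, p.rep 0 + t * p.rep 1 + t ^ 2 * p.rep 2 ≠ 0 := by
  classical
  let q : RP2 → Polynomial ℝ := fun p =>
    Polynomial.C (p.rep 0) + Polynomial.C (p.rep 1) * Polynomial.X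
      + Polynomial.C (p.rep 2) * Polynomial.X ^ 2
  have hq : ∀ p, q p ≠ 0 := by
    intro p h
    apply p.rep_nonzero
    have h0 := congrArg (fun r => Polynomial.coeff r 0) h
    have h1 := congrArg (fun r => Polynomial.coeff r 1) h
    have h2 := congrArg (fun r => Polynomial.coeff r 2) h
    simp [q, Polynomial.coeff_X, Polynomial.coeff_C, Polynomial.coeff_X_pow] at h0 h1 h2
    ext i
    fin_cases i <;> simp [h0, h1, h2]
  have hprod : (∏ p ∈ hfin.toFinset, q p) ≠ 0 := Finset.prod_ne_zero_iff.2 fun p _ => hq p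
  obtain ⟨t, ht⟩ := Polynomial.exists_eval_ne_zero_of_natDegree_lt_card _ hprod
    (by
      refine lt_of_lt_of_le Cardinal.natCast_lt_aleph0 ?_
      exact Cardinal.aleph0_le_mk ℝ)
  refine ⟨t, fun p hp h => ht ?_⟩
  rw [Polynomial.eval_prod]
  refine Finset.prod_eq_zero (hfin.mem_toFinset.2 hp) ?_
  simp only [q, Polynomial.eval_add, Polynomial.eval_mul, Polynomial.eval_C, Polynomial.eval_X,
    Polynomial.eval_pow]
  linarith

end MelchiorBridge

theorem melchior (P : Set RP2) (hfin : P.Finite)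
    (hline : ¬ ∃ L : Set RP2, IsProjLine L ∧ P ⊆ L) :
    3 + ∑ k ∈ Finset.Icc 4 P.ncard, (k - 3) * numKRichLines P k ≤ numKRichLines P 2 := by
  classical
  obtain ⟨t, ht⟩ := exists_affine P hfin
  obtain ⟨S, hS⟩ : ∃ S : Finset RP2, S = hfin.toFinset := ⟨_, rfl⟩
  have hSP : ∀ p, p ∈ S ↔ p ∈ P := by intro p; rw [hS, hfin.mem_toFinset]
  let h : RP2 → ℝ := fun p => p.rep 0 + t * p.rep 1 + t ^ 2 * p.rep 2
  let x : RP2 → ℝ := fun p => p.rep 1 / h p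
  let y : RP2 → ℝ := fun p => p.rep 2 / h p
  have hh : ∀ p ∈ S, h p ≠ 0 := fun p hp => ht p ((hSP p).1 hp)
  let cc : (Fin 3 → ℝ) → ℝ × ℝ × ℝ := fun n => (n 1 - n 0 * t, n 2 - n 0 * t ^ 2, n 0)
  have hev : ∀ n, ∀ p ∈ S, mev x y (cc n) p = 0 ↔
      n 0 * p.rep 0 + n 1 * p.rep 1 + n 2 * p.rep 2 = 0 := by
    intro n p hp
    have e : mev x y (cc n) p = (n 0 * p.rep 0 + n 1 * p.rep 1 + n 2 * p.rep 2) / h p := by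
      have := hh p hp
      simp only [mev, cc, x, y]
      field_simp
      simp only [h]
      ring
    rw [e, div_eq_zero_iff]
    simp [hh p hp]
  have hcc : ∀ c : ℝ × ℝ × ℝ, mnd c → ∃ n, n ≠ 0 ∧ cc n = c := by
    rintro ⟨a, b, e⟩ hc
    refine ⟨![e, a + e * t, b + e * t ^ 2], ?_, by simp [cc]⟩
    intro h0
    have h1 := congrFun h0 0
    have h2 := congrFun h0 1
    have h3 := congrFun h0 2
    simp at h1 h2 h3
    subst h1
    simp [mnd] at hc
    simp at h2 h3
    subst h2 h3
    simp at hc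
  have hnd : ∀ n, n ≠ 0 → ∀ p ∈ S, n 0 * p.rep 0 + n 1 * p.rep 1 + n 2 * p.rep 2 = 0 →
      mnd (cc n) := by
    intro n hn p hp hz
    by_contra hcon
    have hz' := (hev n p hp).2 hz
    simp only [mnd, cc, not_lt] at hcon
    have h1 : n 1 - n 0 * t = 0 := by
      nlinarith [sq_nonneg (n 1 - n 0 * t), sq_nonneg (n 2 - n 0 * t ^ 2)]
    have h2 : n 2 - n 0 * t ^ 2 = 0 := by
      nlinarith [sq_nonneg (n 1 - n 0 * t), sq_nonneg (n 2 - n 0 * t ^ 2)]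
    simp only [mev, cc, h1, h2] at hz'
    have h0 : n 0 = 0 := by linarith
    rw [h0] at h1 h2
    apply hn
    ext i
    fin_cases i
    · exact h0
    · simpa using h1
    · simpa using h2
  have hinj : ∀ p ∈ S, ∀ q ∈ S, x p = x q → y p = y q → p = q := by
    intro p hp q hq hx hy
    rw [← p.mk_rep, ← q.mk_rep, Projectivization.mk_eq_mk_iff']
    have h1 := hh p hp
    have h2 := hh q hq
    have ex : p.rep 1 = h p / h q * q.rep 1 := by
      simp only [x] at hx; field_simp at hx ⊢; linarith
    have ey : p.rep 2 = h p / h q * q.rep 2 := by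
      simp only [y] at hy; field_simp at hy ⊢; linarith
    have ez : h p = h p / h q * h q := by field_simp
    refine ⟨h p / h q, ?_⟩
    set r := h p / h q
    simp only [h] at ez
    ext i
    fin_cases i
    · simp only [Fin.zero_eta, Pi.smul_apply, smul_eq_mul]
      linear_combination -ez + t * ex + t ^ 2 * ey
    · simpa using ex.symm
    · simpa using ey.symm
  have hnc : ∀ c, mnd c → ∃ p ∈ S, mev x y c p ≠ 0 := by
    intro c hc
    obtain ⟨n, hn, rfl⟩ := hcc c hc
    by_contra hcon
    push Not at hcon
    apply hline
    refine ⟨_, (isProjLine_iff _).2 ⟨n, hn, rfl⟩, fun p hp => ?_⟩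
    have hp' := (hSP p).2 hp
    exact (hev n p hp').1 (hcon p hp')
  have hnum : ∀ k, 2 ≤ k →
      numKRichLines P k = ((mtr S x y).filter (fun T => T.card = k)).card := by
    intro k hk
    have hPL : ∀ L : Set RP2, (P ∩ L).ncard = (S.filter (fun p => p ∈ L)).card := by
      intro L
      rw [← Set.ncard_coe_finset]
      congr 1
      ext p
      simp [hSP]
    rw [numKRichLines, ← Set.ncard_coe_finset]
    refine Set.ncard_congr (fun L _ => S.filter (fun p => p ∈ L)) ?_ ?_ ?_
    · rintro L ⟨hL, hcard⟩
      obtain ⟨n, hn, rfl⟩ := (isProjLine_iff L).1 hL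
      rw [hPL] at hcard
      simp only [Finset.coe_filter, Set.mem_ofPred_eq]
      refine ⟨?_, hcard⟩
      obtain ⟨p, hp⟩ := Finset.card_pos.1 (show 0 < (S.filter (fun p => p ∈
        {p : RP2 | n 0 * p.rep 0 + n 1 * p.rep 1 + n 2 * p.rep 2 = 0})).card by omega)
      rw [Finset.mem_filter] at hp
      simp only [mtr, Finset.mem_filter, Finset.mem_powerset]
      refine ⟨Finset.filter_subset _ _, ?_, cc n, hnd n hn p hp.1 hp.2, ?_⟩
      · have h2 := hk
        rw [← hcard] at h2
        exact h2
      · exact Finset.filter_congr fun p hp => (hev n p hp).symm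
    · rintro L L' ⟨hL, hcard⟩ ⟨hL', hcard'⟩ heq
      obtain ⟨n, hn, rfl⟩ := (isProjLine_iff L).1 hL
      obtain ⟨n', hn', rfl⟩ := (isProjLine_iff L').1 hL'
      rw [hPL] at hcard
      obtain ⟨p, hp, q, hq, hpq⟩ := Finset.one_lt_card.1 (show 1 < (S.filter (fun p => p ∈
        {p : RP2 | n 0 * p.rep 0 + n 1 * p.rep 1 + n 2 * p.rep 2 = 0})).card by omega)
      have hp2 := hp
      have hq2 := hq
      rw [heq] at hp2 hq2
      rw [Finset.mem_filter] at hp hq hp2 hq2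
      obtain ⟨r, hr, hrc⟩ := mprop (hnd n hn p hp.1 hp.2) (hnd n' hn' p hp2.1 hp2.2)
        (fun h => hpq (hinj p hp.1 q hq.1 h.1 h.2))
        ((hev n p hp.1).2 hp.2) ((hev n q hq.1).2 hq.2)
        ((hev n' p hp.1).2 hp2.2) ((hev n' q hq.1).2 hq2.2)
      simp only [cc, mscale, Prod.mk.injEq] at hrc
      obtain ⟨e1, e2, e0⟩ := hrc
      have e1' : n 1 = r * n' 1 := by linear_combination e1 + t * e0
      have e2' : n 2 = r * n' 2 := by linear_combination e2 + t ^ 2 * e0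
      ext z
      simp only [Set.mem_ofPred_eq]
      rw [e0, e1', e2', show r * n' 0 * z.rep 0 + r * n' 1 * z.rep 1 + r * n' 2 * z.rep 2
        = r * (n' 0 * z.rep 0 + n' 1 * z.rep 1 + n' 2 * z.rep 2) by ring]
      simp [hr]
    · intro T hT
      simp only [Finset.coe_filter, Set.mem_ofPred_eq] at hT
      obtain ⟨hT, hTk⟩ := hT
      simp only [mtr, Finset.mem_filter, Finset.mem_powerset] at hT
      obtain ⟨-, -, c, hc, hTc⟩ := hT
      obtain ⟨n, hn, rfl⟩ := hcc c hc
      have hTe : S.filter (fun p => p ∈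
          {p : RP2 | n 0 * p.rep 0 + n 1 * p.rep 1 + n 2 * p.rep 2 = 0}) = T := by
        rw [hTc]
        exact Finset.filter_congr fun p hp => (hev n p hp).symm
      refine ⟨_, ⟨(isProjLine_iff _).2 ⟨n, hn, rfl⟩, ?_⟩, hTe⟩
      rw [hPL, hTe, hTk]
  have hcardP : P.ncard = S.card := by
    rw [hS, Set.ncard_eq_toFinset_card P hfin]
  rw [hcardP, hnum 2 le_rfl, Finset.sum_congr rfl (fun k hk => by
    rw [hnum k (by rw [Finset.mem_Icc] at hk; omega)])]
  exact mcore' hinj hnc
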